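/- Every partially holomorphic function on M = (ℝ × ℂ) \ {(0,0)} extends across the origin: if f : M → ℂ is smooth and z ↦ f(ξ, z) is holomorphic on {z : (ξ, z) ∈ M} for each ξ ∈ ℝ, then there exists a smooth function F : ℝ × ℂ → ℂ with z ↦ F(ξ, z) entire for every ξ ∈ ℝ and F = f on M. -/

import Mathlib

open Set Filter Topology MeasureTheory Metric

theorem aux_contDiffOn_integral {H : Type} [NormedAddCommGroup H] [NormedSpace ℝ H]
    [ProperSpace H] {U : Set H} (hU : IsOpen U) (a b : ℝ) (n : ℕ) :
    ∀ {E : Type} [NormedAddCommGroup E] [NormedSpace ℝ E] (K : H × ℝ → E),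
      ContDiffOn ℝ n K (U ×ˢ univ) →
      ContDiffOn ℝ n (fun x => ∫ t in a..b, K (x, t)) U := by
  induction n with
  | zero =>
    intro E _ _ K hK
    have hK : ContinuousOn K (U ×ˢ univ) := hK.continuousOn
    refine contDiffOn_zero.2 ?_
    rw [continuousOn_iff_continuous_domRestrict]
    have := intervalIntegral.continuous_parametric_intervalIntegral_of_continuous' (μ := volume)
      (f := fun (x : U) (t : ℝ) => K (x.1, t)) ?_ a b
    · exact this
    · refine hK.comp_continuous (by fun_prop) ?_
      intro x
      simp
  | succ n ih =>
    intro E _ _ K hK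
    have hopen : IsOpen (U ×ˢ (univ : Set ℝ)) := hU.prod isOpen_univ
    have hKc : ContinuousOn K (U ×ˢ univ) := hK.continuousOn
    have hK1 := ((contDiffOn_succ_iff_fderiv_of_isOpen (n := (n : WithTop ℕ∞)) hopen).1
      (by exact_mod_cast hK))
    set K' : H × ℝ → (H →L[ℝ] E) :=
      fun p => (fderiv ℝ K p).comp (ContinuousLinearMap.inl ℝ H ℝ) with hK'
    have hK'n : ContDiffOn ℝ n K' (U ×ˢ univ) := hK1.2.2.clm_comp contDiffOn_const
    have hK'c : ContinuousOn K' (U ×ˢ univ) := hK'n.continuousOn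
    have hd : ∀ x ∈ U, HasFDerivAt (fun x => ∫ t in a..b, K (x, t))
        (∫ t in a..b, K' (x, t)) x := by
      intro x₀ hx₀
      obtain ⟨r, hr, hrU⟩ := Metric.nhds_basis_closedBall.mem_iff.1 (hU.mem_nhds hx₀)
      obtain ⟨C, hC⟩ := ((isCompact_closedBall x₀ r).prod
        (isCompact_uIcc (a := a) (b := b))).exists_bound_of_continuousOn
        (hK'c.mono (prod_mono hrU (subset_univ _)))
      have hc : ∀ x ∈ U, Continuous fun t => K (x, t) := fun x hx =>
        hKc.comp_continuous (by fun_prop) (by intro t; simp [hx])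
      have hc' : ∀ x ∈ U, Continuous fun t => K' (x, t) := fun x hx =>
        hK'c.comp_continuous (by fun_prop) (by intro t; simp [hx])
      refine intervalIntegral.hasFDerivAt_integral_of_dominated_of_fderiv_le
        (F' := fun x t => K' (x, t)) (bound := fun _ => C)
        (closedBall_mem_nhds x₀ hr) ?_ ((hc x₀ hx₀).intervalIntegrable _ _)
        (hc' x₀ hx₀).aestronglyMeasurable ?_ (by simp) ?_
      · filter_upwards [hU.mem_nhds hx₀] with x hx using (hc x hx).aestronglyMeasurable
      · refine Eventually.of_forall fun t ht x hx => hC (x, t) ⟨hx, uIoc_subset_uIcc ht⟩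
      · refine Eventually.of_forall fun t ht x hx => ?_
        have h1 : HasFDerivAt K (fderiv ℝ K (x, t)) (x, t) :=
          (hK1.1.differentiableAt (hopen.mem_nhds (by simp [hrU hx]))).hasFDerivAt
        exact h1.comp x (hasFDerivAt_prodMk_left x t)
    have := (contDiffOn_succ_iff_fderiv_of_isOpen (n := (n : WithTop ℕ∞)) hU
      (f := fun x => ∫ t in a..b, K (x, t))).2
      ⟨fun x hx => (hd x hx).differentiableAt.differentiableWithinAt, by simp,
        (ih K' hK'n).congr fun x hx => (hd x hx).fderiv⟩
    exact_mod_cast this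

/-- Every partially holomorphic function on `M = (ℝ × ℂ) \ {(0,0)}` extends across the
origin: if `f` is smooth on `M` and holomorphic in the second variable on each slice, then
there is a smooth `F : ℝ × ℂ → ℂ`, entire in the second variable for every fixed first
variable, agreeing with `f` on `M`. -/
theorem stmt_2 (f : ℝ × ℂ → ℂ)
    (hf_smooth : ContDiffOn ℝ (⊤ : ℕ∞) f {((0 : ℝ), (0 : ℂ))}ᶜ)
    (hf_hol : ∀ ξ : ℝ, DifferentiableOn ℂ (fun z => f (ξ, z))
        {z : ℂ | (ξ, z) ≠ ((0 : ℝ), (0 : ℂ))}) :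
    ∃ F : ℝ × ℂ → ℂ, ContDiff ℝ (⊤ : ℕ∞) F ∧
      (∀ ξ : ℝ, Differentiable ℂ (fun z => F (ξ, z))) ∧
      ∀ x : ℝ × ℂ, x ≠ ((0 : ℝ), (0 : ℂ)) → F x = f x := by
  classical
  set U : Set (ℝ × ℂ) := univ ×ˢ ball (0 : ℂ) 1 with hU
  have hUo : IsOpen U := isOpen_univ.prod isOpen_ball
  set K : (ℝ × ℂ) × ℝ → ℂ := fun p =>
    deriv (circleMap 0 1) p.2 • ((circleMap 0 1 p.2 - p.1.2)⁻¹ • f (p.1.1, circleMap 0 1 p.2)) with hK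
  set J : ℝ × ℂ → ℂ := fun x => ∫ t in (0 : ℝ)..(2 * Real.pi), K (x, t) with hJ
  set G : ℝ × ℂ → ℂ := fun x => (2 * Real.pi * Complex.I : ℂ)⁻¹ • J x with hG
  have hcm : ContDiff ℝ (⊤ : ℕ∞) (circleMap 0 1) := contDiff_circleMap 0 1
  have hKs : ContDiffOn ℝ (⊤ : ℕ∞) K (U ×ˢ univ) := by
    have h1 : ContDiffOn ℝ (⊤ : ℕ∞) (fun p : (ℝ × ℂ) × ℝ => circleMap 0 1 p.2) (U ×ˢ univ) :=
      (hcm.comp contDiff_snd).contDiffOn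
    have h2 : ContDiffOn ℝ (⊤ : ℕ∞) (fun p : (ℝ × ℂ) × ℝ => deriv (circleMap 0 1) p.2)
        (U ×ˢ univ) := by
      simp only [deriv_circleMap]
      exact h1.mul contDiffOn_const
    refine h2.smul (ContDiffOn.smul (ContDiffOn.inv (h1.sub (by fun_prop)) ?_) ?_)
    · rintro ⟨⟨x, z⟩, t⟩ hp
      simp only [hU, mem_prod, mem_univ, true_and, and_true] at hp
      exact sub_ne_zero.2 (circleMap_ne_mem_ball hp t)
    · refine hf_smooth.comp (ContDiffOn.prodMk (by fun_prop) h1) ?_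
      rintro ⟨⟨x, z⟩, t⟩ hp
      simp [Prod.ext_iff]
  have hJs : ContDiffOn ℝ (⊤ : ℕ∞) J U := by
    rw [contDiffOn_infty]
    intro n
    exact aux_contDiffOn_integral hUo _ _ n K (hKs.of_le (by exact_mod_cast le_top))
  have hGs : ContDiffOn ℝ (⊤ : ℕ∞) G U := hJs.const_smul (2 * Real.pi * Complex.I : ℂ)⁻¹
  -- Cauchy on slices
  have hG1 : ∀ ξ : ℝ, ξ ≠ 0 → ∀ z ∈ ball (0 : ℂ) 1, G (ξ, z) = f (ξ, z) := by
    intro ξ hξ z hz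
    have hd : DifferentiableOn ℂ (fun z => f (ξ, z)) (closedBall 0 1) :=
      (hf_hol ξ).mono fun w _ => by simp [Prod.ext_iff, hξ]
    have := hd.diffContOnCl_ball (subset_refl _) |>.two_pi_i_inv_smul_circleIntegral_sub_inv_smul hz
    exact this
  have hG2 : ∀ x ∈ U, x ≠ ((0 : ℝ), (0 : ℂ)) → G x = f x := by
    rintro ⟨ξ, z⟩ hx hne
    by_cases hξ : ξ = 0
    · subst hξ
      have hz : z ∈ ball (0 : ℂ) 1 := hx.2
      have hc : Tendsto (fun s : ℝ => ((s, z) : ℝ × ℂ)) (𝓝[≠] 0) (𝓝 (0, z)) :=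
        (Continuous.tendsto (by fun_prop : Continuous fun s : ℝ => ((s, z) : ℝ × ℂ)) 0).mono_left
          nhdsWithin_le_nhds
      have t1 := ((hGs.continuousOn.continuousAt (hUo.mem_nhds hx)).tendsto).comp hc
      have t2 := ((hf_smooth.continuousOn.continuousAt
        (isOpen_compl_singleton.mem_nhds hne)).tendsto).comp hc
      refine tendsto_nhds_unique t1 (t2.congr' ?_)
      filter_upwards [self_mem_nhdsWithin] with s hs
      exact (hG1 s hs z hz).symm
    · exact hG1 ξ hξ z hx.2
  set F : ℝ × ℂ → ℂ := Function.update f (0, 0) (G (0, 0)) with hF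
  have hFf : ∀ x : ℝ × ℂ, x ≠ ((0 : ℝ), (0 : ℂ)) → F x = f x := fun x hx =>
    Function.update_of_ne hx _ _
  have hFG : ∀ x ∈ U, F x = G x := by
    intro x hx
    by_cases h : x = (0, 0)
    · subst h; simp [hF]
    · rw [hFf x h, hG2 x hx h]
  have h0U : ((0 : ℝ), (0 : ℂ)) ∈ U := by simp [hU]
  have hFs : ContDiff ℝ (⊤ : ℕ∞) F := by
    rw [contDiff_iff_contDiffAt]
    intro x
    by_cases h : x = (0, 0)
    · subst h
      exact (hGs.contDiffAt (hUo.mem_nhds h0U)).congr_of_eventuallyEq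
        (eventually_of_mem (hUo.mem_nhds h0U) hFG)
    · have ho : {((0 : ℝ), (0 : ℂ))}ᶜ ∈ 𝓝 x := isOpen_compl_singleton.mem_nhds h
      exact (hf_smooth.contDiffAt ho).congr_of_eventuallyEq (eventually_of_mem ho hFf)
  refine ⟨F, hFs, ?_, hFf⟩
  intro ξ
  have hd : DifferentiableOn ℂ (fun z => F (ξ, z)) {z : ℂ | (ξ, z) ≠ ((0 : ℝ), (0 : ℂ))} :=
    (hf_hol ξ).congr fun z hz => hFf _ hz
  rw [← differentiableOn_univ,
    ← Complex.differentiableOn_compl_singleton_and_continuousAt_iff (c := 0) univ_mem]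
  refine ⟨hd.mono fun z hz => ?_, ?_⟩
  · have : z ≠ 0 := by simpa using hz
    simp [Prod.ext_iff, this]
  · exact (hFs.continuous.comp (by fun_prop : Continuous fun z : ℂ => ((ξ, z) : ℝ × ℂ))).continuousAt
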